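/- In every Muller game G = (A, F0, F1) and for each i ∈ {0,1}, Player i has a winning strategy σ from her winning region W_i(G) such that MaxScore_{F_{1−i}}(ρ) ≤ 2 for every play ρ ∈ Beh(v, σ) with v ∈ W_i(G); that is, σ prevents the opponent from ever reaching a score of 3 for any set in F_{1−i}. -/

import Mathlib

variable {V : Type*}

/-- One step of the score/accumulator update: reading letter `v` after having
score/accumulator pair `s` for the set `F`. -/
def mgStep [DecidableEq V] (F : Finset V) (s : ℕ × Finset V) (v : V) : ℕ × Finset V :=
  if v ∈ F then
    if s.2 = F.erase v then (s.1 + 1, (∅ : Finset V)) else (s.1, insert v s.2)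
  else (0, (∅ : Finset V))

/-- `scoreAcc F w = (Score_F(w), Acc_F(w))` for a (nonempty) finite word `w`. -/
def scoreAcc [DecidableEq V] (F : Finset V) (w : List V) : ℕ × Finset V :=
  w.foldl (mgStep F) (0, ∅)

/-- An arena: a directed graph without terminal vertices, with the positions `V0`
of Player 0; Player 1's positions are the complement. -/
structure Arena (V : Type*) where
  V0 : Set V
  E : V → V → Prop
  succ : ∀ v, ∃ u, E v u

/-- The positions of Player `i`. -/
def Arena.pos (A : Arena V) (i : Fin 2) : Set V := if i = 0 then A.V0 else A.V0ᶜ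

/-- An infinite play in the arena. -/
def IsPlay (A : Arena V) (ρ : ℕ → V) : Prop := ∀ n, A.E (ρ n) (ρ (n + 1))

/-- The prefix `ρ_0 ⋯ ρ_{n-1}` (of length `n`) of an infinite word. -/
def prefixList (ρ : ℕ → V) (n : ℕ) : List V := (List.range n).map ρ

/-- The set of letters occurring infinitely often. -/
def infSet (ρ : ℕ → V) : Set V := {v | ∀ N, ∃ n, N ≤ n ∧ ρ n = v}

/-- The infinity set as a finset. -/
noncomputable def infFinset [Fintype V] (ρ : ℕ → V) : Finset V :=
  (Set.toFinite (infSet ρ)).toFinset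

/-- A loop: a strongly connected subset, i.e. any two of its vertices are joined
by a path visiting only vertices of the set. -/
def IsLoop (A : Arena V) (C : Set V) : Prop :=
  ∀ u ∈ C, ∀ u' ∈ C, Relation.ReflTransGen (fun a b => A.E a b ∧ a ∈ C ∧ b ∈ C) u u'

/-- A strategy, given as a function from (history, current vertex) to the next
vertex, which must move along an edge. -/
def IsStrat (A : Arena V) (σ : List V → V → V) : Prop := ∀ w v, A.E v (σ w v)

/-- A play consistent with the strategy `σ` of Player `i`. -/
def ConsWith (A : Arena V) (i : Fin 2) (σ : List V → V → V) (ρ : ℕ → V) : Prop :=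
  IsPlay A ρ ∧ ∀ n, ρ n ∈ A.pos i → ρ (n + 1) = σ (prefixList ρ n) (ρ n)

/-- The winning region of Player `i` in the Muller game on `A` with winning
families `Fam 0`, `Fam 1`. -/
def MullerWinRegion [Fintype V] [DecidableEq V] (A : Arena V)
    (Fam : Fin 2 → Set (Finset V)) (i : Fin 2) : Set V :=
  {v | ∃ σ, IsStrat A σ ∧ ∀ ρ, ρ 0 = v → ConsWith A i σ ρ → infFinset ρ ∈ Fam i}

section MullerHelpers

set_option linter.unusedSectionVars false

variable [DecidableEq V]

/-- score/accumulator on reversed histories -/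
def sc (F : Finset V) : List V → ℕ × Finset V
  | [] => (0, ∅)
  | v :: h => mgStep F (sc F h) v

/-- burden condition for one set -/
def BO1 (s : ℕ × Finset V) : Prop := s.1 = 0 ∨ (s.1 = 1 ∧ s.2 = ∅)

/-- potential bound -/
def PotLe (R : Set V) (F : Finset V) (s : ℕ × Finset V) (k : ℕ) : Prop :=
  s.1 ≤ k ∧ ((∀ x ∈ F, x ∉ R → x ∈ s.2) → s.1 + 1 ≤ k)

/-- burden condition for all bad subsets of a region -/
def BO (B : Set (Finset V)) (W : Finset V) (h : List V) : Prop :=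
  ∀ F ∈ B, F ⊆ W → BO1 (sc F h)

/-- a set of histories the player can maintain inside the arena `W` -/
def Ctl (own : Set V) (E : V → V → Prop) (W : Finset V) (Inv : List V → Prop) : Prop :=
  ∀ h, Inv h → ∃ v t, h = v :: t ∧ v ∈ W ∧
    (v ∈ own → ∃ u ∈ W, E v u ∧ Inv (u :: h)) ∧
    (v ∉ own → ∀ u ∈ W, E v u → Inv (u :: h))

def Bdd2 (B : Set (Finset V)) (W : Finset V) (Inv : List V → Prop) : Prop :=
  ∀ h, Inv h → ∀ F ∈ B, F ⊆ W → (sc F h).1 ≤ 2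

def SafeH (own : Set V) (E : V → V → Prop) (B : Set (Finset V)) (W : Finset V)
    (h : List V) : Prop :=
  ∃ Inv : List V → Prop, Inv h ∧ Ctl own E W Inv ∧ Bdd2 B W Inv

def OKR (own : Set V) (E : V → V → Prop) (B : Set (Finset V)) (W : Finset V) : Prop :=
  ∀ v ∈ W, ∀ t, BO B W (v :: t) → SafeH own E B W (v :: t)

def TrapR (own : Set V) (E : V → V → Prop) (X W : Finset V) : Prop :=
  ∀ v ∈ W, v ∉ own → ∀ u ∈ X, E v u → u ∈ W

theorem safeH_ctl (own : Set V) (E : V → V → Prop) (B : Set (Finset V)) (W : Finset V) :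
    Ctl own E W (SafeH own E B W) := by
  rintro h ⟨Inv, hI, hC, hB⟩
  obtain ⟨v, t, rfl, hv, h1, h2⟩ := hC h hI
  refine ⟨v, t, rfl, hv, ?_, ?_⟩
  · intro ho
    obtain ⟨u, hu, he, hi⟩ := h1 ho
    exact ⟨u, hu, he, Inv, hi, hC, hB⟩
  · intro ho u hu he
    exact ⟨Inv, h2 ho u hu he, hC, hB⟩

theorem safeH_bdd (own : Set V) (E : V → V → Prop) (B : Set (Finset V)) (W : Finset V) :
    Bdd2 B W (SafeH own E B W) := by
  rintro h ⟨Inv, hI, hC, hB⟩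
  exact hB h hI

theorem step_notMem {F : Finset V} {s : ℕ × Finset V} {v : V} (h : v ∉ F) :
    mgStep F s v = (0, ∅) := by simp [mgStep, h]

theorem sc_notMem {F : Finset V} {v : V} {h : List V} (hv : v ∉ F) :
    sc F (v :: h) = (0, ∅) := step_notMem hv

theorem bo_step {F : Finset V} {s : ℕ × Finset V} {v : V} (h : s.1 = 0) :
    BO1 (mgStep F s v) := by
  unfold mgStep BO1
  split_ifs <;> simp [h]

theorem bo_le {s : ℕ × Finset V} (h : BO1 s) : s.1 ≤ 1 := by
  rcases h with h | h <;> omega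

theorem pot_mono {R : Set V} {F : Finset V} {s : ℕ × Finset V} {k : ℕ}
    (h : s.1 + 1 ≤ k) : PotLe R F s k := ⟨by omega, fun _ => h⟩

theorem pot_of_bo {R : Set V} {F : Finset V} {s : ℕ × Finset V}
    (hF : ∃ x ∈ F, x ∉ R) (h : BO1 s) : PotLe R F s 1 := by
  rcases h with h | ⟨h, h'⟩
  · exact pot_mono (by omega)
  · refine ⟨by omega, fun hx => ?_⟩
    obtain ⟨x, hx1, hx2⟩ := hF
    have := hx x hx1 hx2
    simp [h'] at this

theorem pot_le {R : Set V} {F : Finset V} {s : ℕ × Finset V} {k l : ℕ}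
    (h : PotLe R F s k) (hk : k ≤ l) : PotLe R F s l :=
  ⟨h.1.trans hk, fun hx => (h.2 hx).trans hk⟩

theorem pot_anti {R R' : Set V} {F : Finset V} {s : ℕ × Finset V} {k : ℕ}
    (h : PotLe R F s k) (hR : R' ⊆ R) : PotLe R' F s k :=
  ⟨h.1, fun hx => h.2 fun x h1 h2 => hx x h1 fun h3 => h2 (hR h3)⟩

theorem pot_step {R : Set V} {F : Finset V} {s : ℕ × Finset V} {k : ℕ} {v : V}
    (hF : ∃ x ∈ F, x ∉ R) (hv : v ∈ R) (h : PotLe R F s k) :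
    PotLe R F (mgStep F s v) k := by
  obtain ⟨x, hx1, hx2⟩ := hF
  unfold mgStep
  split_ifs with h1 h2
  · refine ⟨?_, fun hx => ?_⟩
    · apply h.2
      intro y hy hyR
      rw [h2]
      exact Finset.mem_erase.2 ⟨fun e => hyR (e ▸ hv), hy⟩
    · have := hx x hx1 hx2
      simp at this
  · refine ⟨h.1, fun hx => h.2 fun y hy hyR => ?_⟩
    have := hx y hy hyR
    rcases Finset.mem_insert.1 this with e | e
    · exact absurd (e ▸ hv) hyR
    · exact e
  · refine ⟨by simp, fun hx => ?_⟩
    have := hx x hx1 hx2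
    simp at this

theorem pot_step_one {R : Set V} {F : Finset V} {s : ℕ × Finset V} {v : V}
    (hF : ∃ x ∈ F, x ∉ R) (h : s.1 ≤ 1) :
    PotLe R F (mgStep F s v) 2 := by
  obtain ⟨x, hx1, hx2⟩ := hF
  unfold mgStep
  split_ifs with h1 h2
  · refine ⟨by simpa using h, fun hx => ?_⟩
    have := hx x hx1 hx2
    simp at this
  · exact pot_mono (by simpa using h)
  · exact pot_mono (by simp)

theorem bo_single (F : Finset V) (v : V) : BO1 (sc F [v]) := bo_step rfl

theorem notSub {F R : Finset V} (h : ¬ F ⊆ R) : ∃ x ∈ F, x ∉ (R : Set V) := by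
  obtain ⟨x, h1, h2⟩ := Finset.not_subset.1 h
  exact ⟨x, h1, by simpa using h2⟩

/-- Combining a safe region `U` with a region `D` that may only be left towards `U`. -/
theorem ok_union {own : Set V} {E : V → V → Prop} {B : Set (Finset V)} {U D : Finset V}
    (hdis : Disjoint U D) (hU : OKR own E B U) (hUT : TrapR own E (U ∪ D) U)
    (hD : ∀ v ∈ D, ∀ t, BO B D (v :: t) → ∃ Inv : List V → Prop, Inv (v :: t) ∧
      Bdd2 B D Inv ∧ ∀ h, Inv h → ∃ v t, h = v :: t ∧ v ∈ D ∧
        (v ∈ own → ∃ u ∈ U ∪ D, E v u ∧ (u ∈ U ∨ (u ∈ D ∧ Inv (u :: h)))) ∧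
        (v ∉ own → ∀ u ∈ U ∪ D, E v u → (u ∈ U ∨ (u ∈ D ∧ Inv (u :: h))))) :
    OKR own E B (U ∪ D) := by
  have stepU : ∀ u ∈ U, ∀ h : List V,
      (∀ F ∈ B, F ⊆ U ∪ D → ¬ F ⊆ U → PotLe (↑U) F (sc F h) 2) →
      (∀ F ∈ B, F ⊆ U ∪ D → ¬ F ⊆ U → PotLe (↑U) F (sc F (u :: h)) 2) := by
    intro u hu h hh F hF hFs hFU
    exact pot_step (notSub hFU) hu (hh F hF hFs hFU)
  -- the invariant on the `U` part
  set IU : List V → Prop := fun h => SafeH own E B U h ∧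
      ∀ F ∈ B, F ⊆ U ∪ D → ¬ F ⊆ U → PotLe (↑U) F (sc F h) 2 with hIU
  have bU : ∀ h, IU h → ∀ F ∈ B, F ⊆ U ∪ D → (sc F h).1 ≤ 2 := by
    intro h hh F hF hFs
    by_cases hFU : F ⊆ U
    · exact safeH_bdd _ _ _ _ h hh.1 F hF hFU
    · exact (hh.2 F hF hFs hFU).1
  have cU : Ctl own E (U ∪ D) IU := by
    intro h hh
    obtain ⟨v, t, rfl, hv, h1, h2⟩ := safeH_ctl _ _ _ _ h hh.1
    refine ⟨v, t, rfl, Finset.mem_union_left _ hv, ?_, ?_⟩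
    · intro ho
      obtain ⟨u, hu, he, hs⟩ := h1 ho
      exact ⟨u, Finset.mem_union_left _ hu, he, hs, stepU u hu _ hh.2⟩
    · intro ho u hu he
      have hu' := hUT v hv ho u hu he
      exact ⟨h2 ho u hu' he, stepU u hu' _ hh.2⟩
  intro v hv t hBO
  by_cases hvU : v ∈ U
  · refine ⟨IU, ⟨?_, ?_⟩, cU, bU⟩
    · exact hU v hvU t fun F hF hFU => hBO F hF (hFU.trans Finset.subset_union_left)
    · intro F hF hFs hFU
      exact pot_le (pot_of_bo (notSub hFU) (hBO F hF hFs)) (by norm_num)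
  · have hvD : v ∈ D := by
      rcases Finset.mem_union.1 hv with h | h
      · exact absurd h hvU
      · exact h
    obtain ⟨ID, hI, hIb, hIc⟩ := hD v hvD t
      fun F hF hFU => hBO F hF (hFU.trans Finset.subset_union_right)
    have key : ∀ v ∈ D, ∀ t u, (∀ F ∈ B, F ⊆ U ∪ D → ¬ F ⊆ D → PotLe (↑D) F (sc F (v :: t)) 1) →
        (u ∈ U ∨ (u ∈ D ∧ ID (u :: v :: t))) →
        (ID (u :: v :: t) ∧ ∀ F ∈ B, F ⊆ U ∪ D → ¬ F ⊆ D → PotLe (↑D) F (sc F (u :: v :: t)) 1) ∨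
          IU (u :: v :: t) := by
      intro v hv t u hp hu
      rcases hu with hu | ⟨hu, hi⟩
      · right
        have huD : u ∉ D := fun h => Finset.disjoint_left.1 hdis hu h
        have hvU : v ∉ U := fun h => Finset.disjoint_left.1 hdis h hv
        refine ⟨hU u hu _ ?_, ?_⟩
        · intro F hF hFU
          apply bo_step
          rw [sc_notMem fun h => hvU (hFU h)]
        · intro F hF hFs hFU
          by_cases hFD : F ⊆ D
          · rw [sc_notMem fun h => huD (hFD h)]
            exact pot_mono (by norm_num)
          · exact pot_step_one (notSub hFU) (hp F hF hFs hFD).1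
      · left
        refine ⟨hi, fun F hF hFs hFD => ?_⟩
        exact pot_step (notSub hFD) hu (hp F hF hFs hFD)
    refine ⟨fun h => (ID h ∧ ∀ F ∈ B, F ⊆ U ∪ D → ¬ F ⊆ D → PotLe (↑D) F (sc F h) 1) ∨ IU h,
      Or.inl ⟨hI, fun F hF hFs hFD => pot_of_bo (notSub hFD) (hBO F hF hFs)⟩, ?_, ?_⟩
    · rintro h (⟨hi, hp⟩ | hh)
      · obtain ⟨v, t, rfl, hv, h1, h2⟩ := hIc h hi
        refine ⟨v, t, rfl, Finset.mem_union_right _ hv, ?_, ?_⟩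
        · intro ho
          obtain ⟨u, hu, he, hs⟩ := h1 ho
          exact ⟨u, hu, he, key v hv t u hp hs⟩
        · intro ho u hu he
          exact key v hv t u hp (h2 ho u hu he)
      · obtain ⟨v, t, rfl, hv, h1, h2⟩ := cU h hh
        refine ⟨v, t, rfl, hv, ?_, ?_⟩
        · intro ho
          obtain ⟨u, hu, he, hs⟩ := h1 ho
          exact ⟨u, hu, he, Or.inr hs⟩
        · intro ho u hu he
          exact Or.inr (h2 ho u hu he)
    · rintro h (⟨hi, hp⟩ | hh) F hF hFs
      · by_cases hFD : F ⊆ D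
        · exact hIb h hi F hF hFD
        · exact (hp F hF hFs hFD).1.trans (by norm_num)
      · exact bU h hh F hF hFs

theorem sc_tw (F : Finset V) (h : List V) :
    (∀ x ∈ (sc F h).2, x ∈ h.takeWhile (· ∈ F)) ∧
    (1 ≤ (sc F h).1 → ∀ x ∈ F, x ∈ h.takeWhile (· ∈ F)) := by
  induction h with
  | nil => simp [sc]
  | cons v h ih =>
    by_cases hv : v ∈ F
    · have e : (v :: h).takeWhile (· ∈ F) = v :: h.takeWhile (· ∈ F) := by
        simp [hv]
      rw [e]
      simp only [sc, mgStep, hv, if_true]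
      split_ifs with h1
      · refine ⟨by simp, fun _ x hx => ?_⟩
        by_cases hxv : x = v
        · simp [hxv]
        · refine List.mem_cons_of_mem _ (ih.1 x ?_)
          rw [h1]
          exact Finset.mem_erase.2 ⟨hxv, hx⟩
      · refine ⟨fun x hx => ?_, fun hs x hx => List.mem_cons_of_mem _ (ih.2 hs x hx)⟩
        rcases Finset.mem_insert.1 hx with rfl | hx
        · simp
        · exact List.mem_cons_of_mem _ (ih.1 x hx)
    · rw [sc_notMem hv]
      simp

/-- stages of the attractor of `Y \ C` -/
def AtSt (own : Set V) (E : V → V → Prop) (Y C : Finset V) : ℕ → Set V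
  | 0 => {v | v ∈ Y ∧ v ∉ C}
  | n + 1 => AtSt own E Y C n ∪ {v | v ∈ Y ∧
      ((v ∈ own ∧ ∃ u ∈ AtSt own E Y C n, E v u) ∨
       (v ∉ own ∧ ∀ u ∈ Y, E v u → u ∈ AtSt own E Y C n))}

theorem atSt_sub (own : Set V) (E : V → V → Prop) (Y C : Finset V) (n : ℕ) :
    ∀ v ∈ AtSt own E Y C n, v ∈ Y := by
  induction n with
  | zero => intro v hv; exact hv.1
  | succ n ih =>
    rintro v (hv | hv)
    · exact ih v hv
    · exact hv.1

theorem atSt_mono (own : Set V) (E : V → V → Prop) (Y C : Finset V) :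
    Monotone (AtSt own E Y C) :=
  monotone_nat_of_le_succ fun _ _ hx => Or.inl hx

open Classical in
noncomputable def Zset (own : Set V) (E : V → V → Prop) (Y C : Finset V) : Finset V :=
  Y.filter fun v => ∀ n, v ∉ AtSt own E Y C n

theorem mem_Zset {own : Set V} {E : V → V → Prop} {Y C : Finset V} {v : V} :
    v ∈ Zset own E Y C ↔ v ∈ Y ∧ ∀ n, v ∉ AtSt own E Y C n := by
  simp [Zset]

theorem Zset_sub {own : Set V} {E : V → V → Prop} {Y C : Finset V} :
    Zset own E Y C ⊆ C := by
  intro v hv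
  rw [mem_Zset] at hv
  by_contra h
  exact hv.2 0 ⟨hv.1, h⟩

theorem Zset_trap {own : Set V} {E : V → V → Prop} {Y C : Finset V} {v u : V}
    (hv : v ∈ Zset own E Y C) (ho : v ∈ own) (hu : u ∈ Y) (he : E v u) :
    u ∈ Zset own E Y C := by
  rw [mem_Zset] at hv ⊢
  refine ⟨hu, fun n hn => hv.2 (n + 1) (Or.inr ⟨hv.1, Or.inl ⟨ho, u, hn, he⟩⟩)⟩

theorem Zset_sub_arena {own : Set V} {E : V → V → Prop} {Y C : Finset V}
    (hY : ∀ v ∈ Y, ∃ u ∈ Y, E v u) : ∀ v ∈ Zset own E Y C, ∃ u ∈ Zset own E Y C, E v u := by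
  intro v hv
  by_cases ho : v ∈ own
  · obtain ⟨u, hu, he⟩ := hY v (mem_Zset.1 hv).1
    exact ⟨u, Zset_trap hv ho hu he, he⟩
  · by_contra hcon
    push Not at hcon
    have h1 : ∀ u, ∃ n, u ∈ Y → E v u → u ∈ AtSt own E Y C n := by
      intro u
      by_contra hc
      push Not at hc
      refine hcon u (mem_Zset.2 ⟨(hc 0).1, fun n => (hc n).2.2⟩) (hc 0).2.1
    choose f hf using h1
    refine (mem_Zset.1 hv).2 (Y.sup f + 1) (Or.inr ⟨(mem_Zset.1 hv).1, Or.inr ⟨ho, ?_⟩⟩)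
    intro u hu he
    exact atSt_mono own E Y C (Finset.le_sup hu) (hf u hu he)

def FarC (B : Set (Finset V)) (Y C : Finset V) (h : List V) : Prop :=
  ∀ F ∈ B, F ⊆ Y → ¬ F ⊆ C → (sc F h).1 = 0 ∧ (sc F h).2 ⊆ C

theorem far_step {B : Set (Finset V)} {Y C : Finset V} {h : List V} {u : V}
    (hf : FarC B Y C h) (hu : u ∈ C) : FarC B Y C (u :: h) := by
  intro F hF hFY hFC
  obtain ⟨h1, h2⟩ := hf F hF hFY hFC
  simp only [sc, mgStep]
  split_ifs with h3 h4
  · exfalso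
    apply hFC
    intro x hx
    by_cases hxu : x = u
    · exact hxu ▸ hu
    · apply h2
      rw [h4]
      exact Finset.mem_erase.2 ⟨hxu, hx⟩
  · exact ⟨h1, Finset.insert_subset hu h2⟩
  · simp

theorem far_exit {B : Set (Finset V)} {Y C : Finset V} {h : List V} {u : V}
    (hf : FarC B Y C h) (hu : u ∉ C) : BO B Y (u :: h) := by
  intro F hF hFY
  by_cases hFC : F ⊆ C
  · rw [sc_notMem fun h => hu (hFC h)]
    exact Or.inl rfl
  · exact bo_step (hf F hF hFY hFC).1

def ModeN (B : Set (Finset V)) (Y : Finset V) (h : List V) : Prop :=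
  ∃ v t, h = v :: t ∧ v ∈ Y ∧ ∀ F ∈ B, F ⊆ Y → v ∉ F

def ModeZ (own : Set V) (E : V → V → Prop) (B : Set (Finset V)) (Y : Finset V)
    (h : List V) : Prop :=
  ∃ C ∈ B, C ⊆ Y ∧ SafeH own E B (Zset own E Y C) h ∧ FarC B Y C h ∧
    ∀ F ∈ B, F ⊆ Y → ¬ F ⊆ Zset own E Y C → PotLe (↑(Zset own E Y C)) F (sc F h) 1

def ModeA (own : Set V) (E : V → V → Prop) (B : Set (Finset V)) (Y : Finset V)
    (h : List V) : Prop :=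
  ∃ C ∈ B, C ⊆ Y ∧ ∃ n v t, h = v :: t ∧ v ∈ C ∧ v ∈ AtSt own E Y C (n + 1) ∧
    v ∉ AtSt own E Y C n ∧ FarC B Y C h ∧
    ∀ F ∈ B, F ⊆ C → (∃ x ∈ F, x ∉ AtSt own E Y C n) →
      PotLe (AtSt own E Y C n) F (sc F h) 2

theorem mkA {own : Set V} {E : V → V → Prop} {B : Set (Finset V)} {Y C : Finset V}
    (hC : C ∈ B) (hCY : C ⊆ Y) {u : V} {h : List V} {m : ℕ} (hu : u ∈ C)
    (hm : u ∈ AtSt own E Y C m) (hf : FarC B Y C (u :: h))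
    (hp : ∀ n < m, ∀ F ∈ B, F ⊆ C → (∃ x ∈ F, x ∉ AtSt own E Y C n) →
      PotLe (AtSt own E Y C n) F (sc F (u :: h)) 2) : ModeA own E B Y (u :: h) := by
  classical
  have hex : ∃ k, u ∈ AtSt own E Y C k := ⟨m, hm⟩
  obtain ⟨k, hk, hmin⟩ : ∃ k, u ∈ AtSt own E Y C k ∧ ∀ j < k, u ∉ AtSt own E Y C j :=
    ⟨Nat.find hex, Nat.find_spec hex, fun j hj => Nat.find_min hex hj⟩
  have hkm : k ≤ m := by
    by_contra hc
    exact hmin m (by omega) hm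
  cases k with
  | zero => exact absurd hu hk.2
  | succ n =>
    exact ⟨C, hC, hCY, n, u, h, rfl, hu, hk, hmin n (by omega), hf, hp n (by omega)⟩

def ModeAll (own : Set V) (E : V → V → Prop) (B : Set (Finset V)) (Y : Finset V)
    (h : List V) : Prop :=
  ModeN B Y h ∨ ModeZ own E B Y h ∨ ModeA own E B Y h

theorem mode_of_bo {own : Set V} {E : V → V → Prop} {B : Set (Finset V)} {Y : Finset V}
    (hZ : ∀ C ∈ B, C ⊆ Y → OKR own E B (Zset own E Y C)) {v : V} {t : List V} (hv : v ∈ Y)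
    (hBO : BO B Y (v :: t)) : ModeAll own E B Y (v :: t) := by
  classical
  by_cases hex : ∃ C ∈ B, C ⊆ Y ∧ v ∈ C
  swap
  · left
    exact ⟨v, t, rfl, hv, fun F hF hFY hvF => hex ⟨F, hF, hFY, hvF⟩⟩
  right
  obtain ⟨C0, hC0, hC0Y, hvC0⟩ := hex
  obtain ⟨C, hCm, hmax⟩ := Finset.exists_max_image (Y.powerset.filter (· ∈ B))
    (fun C => ((v :: t).takeWhile (· ∈ C)).length)
    ⟨C0, by simp [hC0, hC0Y]⟩
  simp only [Finset.mem_filter, Finset.mem_powerset] at hCm hmax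
  obtain ⟨hCY, hC⟩ := hCm
  have hvC : v ∈ C := by
    by_contra hc
    have := hmax C0 ⟨hC0Y, hC0⟩
    simp [hc, hvC0] at this
  have hpre : ∀ F ∈ B, F ⊆ Y → ∀ x ∈ (v :: t).takeWhile (· ∈ F), x ∈ C := by
    intro F hF hFY x hx
    have h1 : (v :: t).takeWhile (· ∈ F) <+: (v :: t).takeWhile (· ∈ C) :=
      List.prefix_of_prefix_length_le (List.takeWhile_prefix _) (List.takeWhile_prefix _)
        (hmax F ⟨hFY, hF⟩)
    have h2 := h1.subset hx
    simpa using List.mem_takeWhile_imp h2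
  have hfar : FarC B Y C (v :: t) := by
    intro F hF hFY hFC
    obtain ⟨h1, h2⟩ := sc_tw F (v :: t)
    refine ⟨?_, fun x hx => hpre F hF hFY x (h1 x hx)⟩
    by_contra hne
    exact hFC fun x hx => hpre F hF hFY x (h2 (by omega) x hx)
  by_cases hvZ : v ∈ Zset own E Y C
  · left
    refine ⟨C, hC, hCY, hZ C hC hCY v hvZ t ?_, hfar, ?_⟩
    · intro F hF hFZ
      exact hBO F hF ((hFZ.trans Zset_sub).trans hCY)
    · intro F hF hFY hFZ
      exact pot_of_bo (notSub hFZ) (hBO F hF hFY)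
  · right
    have : ∃ m, v ∈ AtSt own E Y C m := by
      by_contra hc
      push Not at hc
      exact hvZ (mem_Zset.2 ⟨hv, hc⟩)
    obtain ⟨m, hm⟩ := this
    refine mkA hC hCY hvC hm hfar ?_
    intro n _ F hF hFC hFx
    exact pot_le (pot_of_bo hFx (hBO F hF (hFC.trans hCY))) (by norm_num)

theorem ok_phase {own : Set V} {E : V → V → Prop} {B : Set (Finset V)} {Y : Finset V}
    (hY : ∀ v ∈ Y, ∃ u ∈ Y, E v u)
    (hZ : ∀ C ∈ B, C ⊆ Y → OKR own E B (Zset own E Y C)) : OKR own E B Y := by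
  intro v hv t hBO
  refine ⟨ModeAll own E B Y, mode_of_bo hZ hv hBO, ?_, ?_⟩
  · rintro h (hN | hM | hA)
    · obtain ⟨v, t, rfl, hv, hF⟩ := hN
      have key : ∀ u ∈ Y, ModeAll own E B Y (u :: v :: t) := by
        intro u hu
        refine mode_of_bo hZ hu fun F hFB hFY => bo_step ?_
        rw [sc_notMem (hF F hFB hFY)]
      refine ⟨v, t, rfl, hv, fun _ => ?_, fun _ u hu _ => key u hu⟩
      obtain ⟨u, hu, he⟩ := hY v hv
      exact ⟨u, hu, he, key u hu⟩
    · obtain ⟨C, hC, hCY, hs, hf, hp⟩ := hM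
      obtain ⟨v, t, rfl, hv, h1, h2⟩ := safeH_ctl _ _ _ _ h hs
      have key : ∀ u ∈ Zset own E Y C, SafeH own E B (Zset own E Y C) (u :: v :: t) →
          ModeAll own E B Y (u :: v :: t) := by
        intro u hu hs'
        refine Or.inr (Or.inl ⟨C, hC, hCY, hs', far_step hf (Zset_sub hu), ?_⟩)
        intro F hF hFY hFZ
        exact pot_step (notSub hFZ) hu (hp F hF hFY hFZ)
      refine ⟨v, t, rfl, (mem_Zset.1 hv).1, ?_, ?_⟩
      · intro ho
        obtain ⟨u, hu, he, hs'⟩ := h1 ho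
        exact ⟨u, (mem_Zset.1 hu).1, he, key u hu hs'⟩
      · intro ho u hu he
        by_cases huZ : u ∈ Zset own E Y C
        · exact key u huZ (h2 ho u huZ he)
        by_cases huC : u ∈ C
        · have : ∃ m, u ∈ AtSt own E Y C m := by
            by_contra hc
            push Not at hc
            exact huZ (mem_Zset.2 ⟨hu, hc⟩)
          obtain ⟨m, hm⟩ := this
          refine Or.inr (Or.inr (mkA hC hCY huC hm (far_step hf huC) ?_))
          intro n _ F hF hFC hFx
          by_cases hFZ : F ⊆ Zset own E Y C
          · rw [sc_notMem fun h => huZ (hFZ h)]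
            exact pot_mono (by norm_num)
          · exact pot_step_one hFx (hp F hF (hFC.trans hCY) hFZ).1
        · exact mode_of_bo hZ hu (far_exit hf huC)
    · obtain ⟨C, hC, hCY, n, v, t, rfl, hvC, hv1, hv0, hf, hp⟩ := hA
      have key : ∀ u ∈ AtSt own E Y C n, ModeAll own E B Y (u :: v :: t) := by
        intro u hu
        by_cases huC : u ∈ C
        · refine Or.inr (Or.inr (mkA hC hCY huC hu (far_step hf huC) ?_))
          intro k hk F hF hFC hFx
          by_cases hFn : ∃ x ∈ F, x ∉ AtSt own E Y C n
          · exact pot_anti (pot_step hFn hu (hp F hF hFC hFn)) (atSt_mono own E Y C hk.le)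
          · have hvF : v ∉ F := fun h => hFn ⟨v, h, hv0⟩
            refine pot_le (pot_of_bo hFx (bo_step ?_)) (by norm_num : 1 ≤ 2)
            rw [sc_notMem hvF]
        · exact mode_of_bo hZ (atSt_sub _ _ _ _ _ u hu) (far_exit hf huC)
      have hv' : v ∈ Y ∧ ((v ∈ own ∧ ∃ u ∈ AtSt own E Y C n, E v u) ∨
        (v ∉ own ∧ ∀ u ∈ Y, E v u → u ∈ AtSt own E Y C n)) := by
        rcases hv1 with h | h
        · exact absurd h hv0
        · exact h
      refine ⟨v, t, rfl, hv'.1, ?_, ?_⟩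
      · intro ho
        rcases hv'.2 with ⟨_, u, hu, he⟩ | ⟨h, _⟩
        · exact ⟨u, atSt_sub _ _ _ _ _ u hu, he, key u hu⟩
        · exact absurd ho h
      · intro ho u hu he
        rcases hv'.2 with ⟨h, _⟩ | ⟨_, h⟩
        · exact absurd h ho
        · exact key u (h u hu he)
  · rintro h (hN | hM | hA) F hF hFY
    · obtain ⟨v, t, rfl, hv, hvF⟩ := hN
      rw [sc_notMem (hvF F hF hFY)]
      norm_num
    · obtain ⟨C, hC, hCY, hs, hf, hp⟩ := hM
      by_cases hFZ : F ⊆ Zset own E Y C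
      · exact safeH_bdd _ _ _ _ h hs F hF hFZ
      · exact (hp F hF hFY hFZ).1.trans (by norm_num)
    · obtain ⟨C, hC, hCY, n, v, t, rfl, hvC, hv1, hv0, hf, hp⟩ := hA
      by_cases hFC : F ⊆ C
      · by_cases hFn : ∃ x ∈ F, x ∉ AtSt own E Y C n
        · exact (hp F hF hFC hFn).1
        · rw [sc_notMem fun h => hFn ⟨v, h, hv0⟩]
          norm_num
      · rw [(hf F hF hFY hFC).1]
        norm_num

def Split (own : Set V) (E : V → V → Prop) (B : Set (Finset V)) (X : Finset V) : Prop :=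
  ∃ W W' : Finset V, W ∪ W' = X ∧ Disjoint W W' ∧ OKR own E B W ∧ TrapR own E X W ∧
    OKR ownᶜ E Bᶜ W' ∧ TrapR ownᶜ E X W'

theorem Split.swap {own : Set V} {E : V → V → Prop} {B : Set (Finset V)} {X : Finset V}
    (h : Split ownᶜ E Bᶜ X) : Split own E B X := by
  obtain ⟨W, W', h1, h2, h3, h4, h5, h6⟩ := h
  rw [compl_compl] at h5 h6
  rw [compl_compl] at h5
  exact ⟨W', W, by rw [Finset.union_comm, h1], h2.symm, h5, h6, h3, h4⟩

theorem split_half {own : Set V} {E : V → V → Prop} {B : Set (Finset V)} {X : Finset V}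
    (hX : ∀ v ∈ X, ∃ u ∈ X, E v u) (hXB : X ∉ B)
    (ih : ∀ Z, Z ⊂ X → (∀ v ∈ Z, ∃ u ∈ Z, E v u) → Split own E B Z) : Split own E B X := by
  classical
  obtain ⟨U, hUm, hmax⟩ := Finset.exists_max_image
    (X.powerset.filter fun U => OKR ownᶜ E Bᶜ U ∧ TrapR ownᶜ E X U) Finset.card
    ⟨∅, by simp [OKR, TrapR]⟩
  simp only [Finset.mem_filter, Finset.mem_powerset] at hUm hmax
  obtain ⟨hUX, hUok, hUT⟩ := hUm
  have maxi : ∀ D, D ⊆ X → Disjoint U D → OKR ownᶜ E Bᶜ (U ∪ D) → TrapR ownᶜ E X (U ∪ D) →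
      D = ∅ := by
    intro D hDX hdis h1 h2
    have := hmax (U ∪ D) ⟨Finset.union_subset hUX hDX, h1, h2⟩
    rw [Finset.card_union_of_disjoint hdis] at this
    exact Finset.card_eq_zero.1 (by omega)
  have trapUD : ∀ D, D ⊆ X → TrapR ownᶜ E (U ∪ D) U := fun D hD v hv ho u hu he =>
    hUT v hv ho u (Finset.union_subset hUX hD hu) he
  -- attractor closure
  have ext1 : ∀ v ∈ X, v ∉ U → (v ∉ own → ∃ u ∈ U, E v u) →
      (v ∈ own → ∀ u ∈ X, E v u → u ∈ U) → False := by
    intro v hvX hvU h1 h2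
    have hdis : Disjoint U {v} := Finset.disjoint_singleton_right.2 hvU
    have hDX : ({v} : Finset V) ⊆ X := Finset.singleton_subset_iff.2 hvX
    have := maxi {v} hDX hdis ?_ ?_
    · simp at this
    · refine ok_union hdis hUok (trapUD _ hDX) ?_
      intro v' hv' t hBO
      obtain rfl := Finset.mem_singleton.1 hv'
      refine ⟨fun h => h = v' :: t, rfl, ?_, ?_⟩
      · rintro h rfl F hF hFD
        exact (bo_le (hBO F hF hFD)).trans (by norm_num)
      · rintro h rfl
        refine ⟨v', t, rfl, hv', ?_, ?_⟩
        · intro ho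
          obtain ⟨u, hu, he⟩ := h1 ho
          exact ⟨u, Finset.mem_union_left _ hu, he, Or.inl hu⟩
        · intro ho u hu he
          exact Or.inl (h2 (by simpa using ho) u (Finset.union_subset hUX hDX hu) he)
    · intro v' hv' ho u hu he
      rcases Finset.mem_union.1 hv' with h | h
      · exact Finset.mem_union_left _ (hUT v' h ho u hu he)
      · obtain rfl := Finset.mem_singleton.1 h
        exact Finset.mem_union_left _ (h2 (by simpa using ho) u hu he)
  set Y := X \ U with hYdef
  have hYT : TrapR own E X Y := by
    intro v hv ho u hu he
    rw [hYdef, Finset.mem_sdiff] at hv ⊢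
    refine ⟨hu, fun huU => ?_⟩
    exact ext1 v hv.1 hv.2 (fun _ => ⟨u, huU, he⟩) fun h => absurd h ho
  have hYs : ∀ v ∈ Y, ∃ u ∈ Y, E v u := by
    intro v hv
    by_cases ho : v ∈ own
    · by_contra hc
      push Not at hc
      have hv' := Finset.mem_sdiff.1 hv
      refine ext1 v hv'.1 hv'.2 (fun h => absurd ho h) fun _ u hu he => ?_
      by_contra huU
      exact hc u (Finset.mem_sdiff.2 ⟨hu, huU⟩) he
    · obtain ⟨u, hu, he⟩ := hX v (Finset.mem_sdiff.1 hv).1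
      exact ⟨u, hYT v hv ho u hu he, he⟩
  have hYX : Y ⊆ X := Finset.sdiff_subset
  refine ⟨Y, U, Finset.sdiff_union_of_subset hUX, Finset.sdiff_disjoint, ?_, hYT, hUok, hUT⟩
  refine ok_phase hYs fun C hC hCY => ?_
  have hCX : C ⊂ X := by
    refine (hCY.trans hYX).ssubset_of_ne ?_
    rintro rfl
    exact hXB hC
  obtain ⟨W, W', hWu, hWd, hWok, hWT, hWok', hWT'⟩ := ih (Zset own E Y C)
    (Finset.ssubset_of_subset_of_ssubset Zset_sub hCX) (Zset_sub_arena hYs)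
  have hW'Z : W' ⊆ Zset own E Y C := hWu ▸ Finset.subset_union_right
  have hW'Y : W' ⊆ Y := fun x hx => (mem_Zset.1 (hW'Z hx)).1
  have hW'X : W' ⊆ X := hW'Y.trans hYX
  have hdis : Disjoint U W' :=
    Finset.disjoint_left.2 fun x hx hx' => (Finset.mem_sdiff.1 (hW'Y hx')).2 hx
  have htr : ∀ v ∈ W', v ∉ ownᶜ → ∀ u ∈ X, E v u → u ∈ U ∨ u ∈ W' := by
    intro v hv ho u hu he
    by_cases huU : u ∈ U
    · exact Or.inl huU
    · right
      exact hWT' v hv ho u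
        (Zset_trap (hW'Z hv) (by simpa using ho) (Finset.mem_sdiff.2 ⟨hu, huU⟩) he) he
  have hE : W' = ∅ := by
    refine maxi W' hW'X hdis ?_ ?_
    · refine ok_union hdis hUok (trapUD _ hW'X) ?_
      intro v hv t hBO
      refine ⟨SafeH ownᶜ E Bᶜ W', hWok' v hv t hBO, safeH_bdd _ _ _ _, ?_⟩
      intro h hs
      obtain ⟨v, t, rfl, hv, h1, h2⟩ := safeH_ctl _ _ _ _ h hs
      refine ⟨v, t, rfl, hv, ?_, ?_⟩
      · intro ho
        obtain ⟨u, hu, he, hs'⟩ := h1 ho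
        exact ⟨u, Finset.mem_union_right _ hu, he, Or.inr ⟨hu, hs'⟩⟩
      · intro ho u hu he
        rcases Finset.mem_union.1 hu with hu | hu
        · exact Or.inl hu
        · exact Or.inr ⟨hu, h2 ho u hu he⟩
    · intro v hv ho u hu he
      rcases Finset.mem_union.1 hv with h | h
      · exact Finset.mem_union_left _ (hUT v h ho u hu he)
      · exact Finset.mem_union.2 (htr v h ho u hu he)
  rw [hE, Finset.union_empty] at hWu
  exact hWu ▸ hWok

theorem split_all (E : V → V → Prop) (X : Finset V) : ∀ (own : Set V) (B : Set (Finset V)),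
    (∀ v ∈ X, ∃ u ∈ X, E v u) → Split own E B X := by
  induction X using Finset.strongInduction with
  | H X ih =>
    intro own B hX
    by_cases hXB : X ∈ B
    · apply Split.swap
      exact split_half hX (by simpa using hXB) fun Z hZ hs => ih Z hZ _ _ hs
    · exact split_half hX hXB fun Z hZ hs => ih Z hZ _ _ hs

theorem scoreAcc_eq (F : Finset V) (w : List V) : scoreAcc F w = sc F w.reverse := by
  induction w using List.reverseRecOn with
  | nil => rfl
  | append_singleton w v ih =>
    rw [List.reverse_append]
    simp only [scoreAcc, List.foldl_append] at ih ⊢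
    simp [sc, ih]

theorem sc_acc (F : Finset V) (hF : F.Nonempty) (h : List V) :
    (sc F h).2 ⊂ F := by
  induction h with
  | nil => simpa [sc] using hF
  | cons v h ih =>
    simp only [sc, mgStep]
    split_ifs with h1 h2
    · simpa using hF
    · refine (Finset.insert_subset h1 ih.1).ssubset_of_ne fun he => ?_
      by_cases hv : v ∈ (sc F h).2
      · rw [Finset.insert_eq_of_mem hv] at he
        exact ih.ne he
      · apply h2
        have h3 := Finset.erase_insert hv
        rw [he] at h3
        exact h3.symm
    · simpa using hF

/-- reversed prefix of length `n+1` -/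
def rpre (ρ : ℕ → V) : ℕ → List V
  | 0 => [ρ 0]
  | n + 1 => ρ (n + 1) :: rpre ρ n

theorem rpre_eq (ρ : ℕ → V) (n : ℕ) : (prefixList ρ (n + 1)).reverse = rpre ρ n := by
  induction n with
  | zero => simp [prefixList, rpre]
  | succ n ih =>
    rw [rpre, ← ih]
    simp only [prefixList]
    rw [List.range_succ (n := n + 1)]
    simp

theorem rpre_head (ρ : ℕ → V) (n : ℕ) : rpre ρ n = ρ n :: (prefixList ρ n).reverse := by
  cases n with
  | zero => simp [prefixList, rpre]
  | succ n => rw [rpre_eq, rpre]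

theorem score_unbdd [Fintype V] [Nonempty V] (ρ : ℕ → V) (k : ℕ) :
    ∃ n, k < (sc (infFinset ρ) (rpre ρ n)).1 := by
  set F := infFinset ρ with hFdef
  have hmem : ∀ v, v ∈ F ↔ ∀ N, ∃ n, N ≤ n ∧ ρ n = v := by
    intro v; simp [hFdef, infFinset, infSet]
  -- eventually in F
  have hev : ∃ N, ∀ n, N ≤ n → ρ n ∈ F := by
    have h1 : ∀ v, ∃ N, v ∉ F → ∀ n, N ≤ n → ρ n ≠ v := by
      intro v
      by_cases hv : v ∈ F
      · exact ⟨0, fun h => absurd hv h⟩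
      · have := mt (hmem v).2 hv
        push Not at this
        obtain ⟨N, hN⟩ := this
        exact ⟨N, fun _ => hN⟩
    choose f hf using h1
    refine ⟨Finset.univ.sup f, fun n hn => ?_⟩
    by_contra hc
    exact hf (ρ n) hc n ((Finset.le_sup (Finset.mem_univ _)).trans hn) rfl
  obtain ⟨N, hN⟩ := hev
  have hFne : F.Nonempty := ⟨ρ N, hN N le_rfl⟩
  have hstep : ∀ n, N ≤ n → (sc F (rpre ρ n)).1 ≤ (sc F (rpre ρ (n + 1))).1 := by
    intro n hn
    have := hN (n + 1) (by omega)
    simp only [rpre, sc, mgStep, this, if_true]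
    split_ifs <;> simp
  have hprog : ∀ n, N ≤ n → ∃ m, n ≤ m ∧ (sc F (rpre ρ n)).1 < (sc F (rpre ρ m)).1 := by
    intro n hn
    by_contra hcon
    push Not at hcon
    have hconst : ∀ d, (sc F (rpre ρ (n + d))).1 = (sc F (rpre ρ n)).1 := by
      intro d
      induction d with
      | zero => rfl
      | succ d ih =>
        apply le_antisymm (hcon _ (by omega))
        rw [← ih]
        exact hstep (n + d) (by omega)
    have hacc : ∀ d j, n < j → j ≤ n + d → ρ j ∈ (sc F (rpre ρ (n + d))).2 := by
      intro d
      induction d with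
      | zero => intro j h1 h2; omega
      | succ d ih =>
        intro j h1 h2
        have hin := hN (n + (d + 1)) (by omega)
        have e : sc F (rpre ρ (n + (d + 1))) =
          mgStep F (sc F (rpre ρ (n + d))) (ρ (n + (d + 1))) := rfl
        have hc1 := hconst (d + 1)
        have hc0 := hconst d
        rw [e] at hc1 ⊢
        unfold mgStep at hc1 ⊢
        rw [if_pos hin] at hc1 ⊢
        split_ifs at hc1 ⊢ with h3
        · simp at hc1; omega
        · by_cases hj : j = n + (d + 1)
          · simp [hj]
          · exact Finset.mem_insert_of_mem (ih j h1 (by omega))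
    have hvis : ∀ v, ∃ j, v ∈ F → n < j ∧ ρ j = v := by
      intro v
      by_cases hv : v ∈ F
      · obtain ⟨j, hj, hj'⟩ := (hmem v).1 hv (n + 1)
        exact ⟨j, fun _ => ⟨by omega, hj'⟩⟩
      · exact ⟨0, fun h => absurd h hv⟩
    choose f hf using hvis
    have hss := sc_acc F hFne (rpre ρ (n + F.sup f))
    refine hss.2 fun v hv => ?_
    have h1 := hf v hv
    have h2 := hacc (F.sup f) (f v) h1.1 ((Finset.le_sup hv).trans (by omega))
    rwa [h1.2] at h2
  have : ∀ k, ∃ n, N ≤ n ∧ k ≤ (sc F (rpre ρ n)).1 := by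
    intro k
    induction k with
    | zero => exact ⟨N, le_rfl, by omega⟩
    | succ k ih =>
      obtain ⟨n, hn, hk⟩ := ih
      obtain ⟨m, hm, hlt⟩ := hprog n hn
      exact ⟨m, by omega, by omega⟩
  obtain ⟨n, _, h⟩ := this (k + 1)
  exact ⟨n, h⟩

theorem inf_loop [Fintype V] (A : Arena V) (ρ : ℕ → V) (hρ : IsPlay A ρ) :
    IsLoop A (↑(infFinset ρ) : Set V) := by
  have hmem : ∀ v, v ∈ infFinset ρ ↔ ∀ N, ∃ n, N ≤ n ∧ ρ n = v := by
    intro v; simp [infFinset, infSet]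
  have hev : ∃ N, ∀ n, N ≤ n → ρ n ∈ infFinset ρ := by
    have h1 : ∀ v, ∃ N, v ∉ infFinset ρ → ∀ n, N ≤ n → ρ n ≠ v := by
      intro v
      by_cases hv : v ∈ infFinset ρ
      · exact ⟨0, fun h => absurd hv h⟩
      · have := mt (hmem v).2 hv
        push Not at this
        obtain ⟨N, hN⟩ := this
        exact ⟨N, fun _ => hN⟩
    choose f hf using h1
    refine ⟨Finset.univ.sup f, fun n hn => ?_⟩
    by_contra hc
    exact hf (ρ n) hc n ((Finset.le_sup (Finset.mem_univ _)).trans hn) rfl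
  obtain ⟨N, hN⟩ := hev
  intro u hu u' hu'
  obtain ⟨n, hn, rfl⟩ := (hmem u).1 hu N
  obtain ⟨m, hm, rfl⟩ := (hmem u').1 hu' n
  obtain ⟨d, rfl⟩ := Nat.exists_eq_add_of_le hm
  clear hm hu'
  induction d with
  | zero => exact Relation.ReflTransGen.refl
  | succ d ih =>
    exact ih.tail ⟨hρ _, hN _ (by omega), hN _ (by omega)⟩

/-- plays staying in a safe set of histories do not have a bad infinity set -/
theorem inf_not_bad [Fintype V] {own : Set V} {E : V → V → Prop} {B : Set (Finset V)}
    {W : Finset V} (ρ : ℕ → V) (h : ∀ n, SafeH own E B W (rpre ρ n)) :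
    infFinset ρ ∉ B := by
  intro hB
  have : Nonempty V := ⟨ρ 0⟩
  have hW : ∀ n, ρ n ∈ W := by
    intro n
    obtain ⟨v, t, he, hv, _⟩ := safeH_ctl _ _ _ _ _ (h n)
    rw [rpre_head] at he
    injection he with e1 e2
    exact e1 ▸ hv
  have hs : infFinset ρ ⊆ W := by
    intro v hv
    have : ∀ N, ∃ n, N ≤ n ∧ ρ n = v := by simpa [infFinset, infSet] using hv
    obtain ⟨n, _, rfl⟩ := this 0
    exact hW n
  obtain ⟨n, hn⟩ := score_unbdd ρ 2
  have := safeH_bdd _ _ _ _ _ (h n) _ hB hs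
  omega

/-- The region of the opponent contains no winning vertex. -/
theorem not_win [Fintype V] {A : Arena V} {Fam : Fin 2 → Set (Finset V)} {i : Fin 2}
    {B : Set (Finset V)} {W : Finset V} (hB : ∀ F ∈ Fam i, F ∈ B)
    (hok : OKR (A.pos i)ᶜ A.E B W) (htr : TrapR (A.pos i)ᶜ A.E Finset.univ W)
    {v : V} (hv : v ∈ W) : v ∉ MullerWinRegion A Fam i := by
  classical
  rintro ⟨σ, hσ, hwin⟩
  have h0 : SafeH (A.pos i)ᶜ A.E B W [v] := hok v hv [] fun F _ _ => bo_single F v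
  have hnext : ∀ h : {h : List V // SafeH (A.pos i)ᶜ A.E B W h},
      ∃ h' : {h : List V // SafeH (A.pos i)ᶜ A.E B W h}, ∃ u x t, h.1 = x :: t ∧ h'.1 = u :: h.1 ∧
        A.E x u ∧ (x ∈ A.pos i → u = σ t.reverse x) := by
    rintro ⟨h, hs⟩
    obtain ⟨x, t, rfl, hx, h1, h2⟩ := safeH_ctl _ _ _ _ _ hs
    by_cases ho : x ∈ A.pos i
    · have he := hσ t.reverse x
      have hu := htr x hx (by simpa using ho) _ (Finset.mem_univ _) he
      exact ⟨⟨_, h2 (by simpa using ho) _ hu he⟩, _, x, t, rfl, rfl, he, fun _ => rfl⟩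
    · obtain ⟨u, hu, he, hs'⟩ := h1 ho
      exact ⟨⟨_, hs'⟩, u, x, t, rfl, rfl, he, fun h => absurd h ho⟩
  choose nx hnx using hnext
  let H : ℕ → {h : List V // SafeH (A.pos i)ᶜ A.E B W h} := fun n => nx^[n] ⟨[v], h0⟩
  have hHs : ∀ n, H (n + 1) = nx (H n) := fun n => Function.iterate_succ_apply' _ _ _
  let ρ : ℕ → V := fun n => (H n).1.headD v
  have hpre : ∀ n, (H n).1 = rpre ρ n := by
    intro n
    induction n with
    | zero => rfl
    | succ n ih =>
      obtain ⟨u, x, t, e1, e2, _, _⟩ := hnx (H n)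
      rw [← hHs] at e2
      have : ρ (n + 1) = u := by simp [ρ, e2]
      rw [e2, rpre, this, ih]
  have hstep : ∀ n, A.E (ρ n) (ρ (n + 1)) ∧
      (ρ n ∈ A.pos i → ρ (n + 1) = σ (prefixList ρ n) (ρ n)) := by
    intro n
    obtain ⟨u, x, t, e1, e2, he, hc⟩ := hnx (H n)
    rw [← hHs] at e2
    have h1 : ρ (n + 1) = u := by simp [ρ, e2]
    rw [hpre, rpre_head] at e1
    injection e1 with e3 e4
    subst e3
    rw [h1]
    refine ⟨he, fun h => ?_⟩
    rw [hc h, ← e4, List.reverse_reverse]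
  have hw := hwin ρ rfl ⟨fun n => (hstep n).1, fun n => (hstep n).2⟩
  exact inf_not_bad ρ (fun n => hpre n ▸ (H n).2) (hB _ hw)

end MullerHelpers

/-- In every Muller game, Player `i` has a winning strategy from her
winning region that in addition bounds all scores of sets in `Fam (1-i)` by 2
along every consistent play starting in the winning region. -/
theorem exists_score_bounding_winning_strategy [Fintype V] [DecidableEq V]
    (A : Arena V) (Fam : Fin 2 → Set (Finset V))
    (hcover : ∀ C : Finset V, C ∈ Fam 0 ∪ Fam 1 ↔ IsLoop A (↑C : Set V))
    (hdisj : Disjoint (Fam 0) (Fam 1)) (i : Fin 2) :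
    ∃ σ : List V → V → V, IsStrat A σ ∧
      ∀ v ∈ MullerWinRegion A Fam i, ∀ ρ, ρ 0 = v → ConsWith A i σ ρ →
        infFinset ρ ∈ Fam i ∧
          ∀ F ∈ Fam (1 - i), ∀ n, (scoreAcc F (prefixList ρ (n + 1))).1 ≤ 2 := by
  classical
  have hcompl : ∀ F, F ∈ Fam i → F ∈ (Fam (1 - i))ᶜ := by
    intro F hF hF'
    fin_cases i
    · exact Set.disjoint_left.1 hdisj hF hF'
    · exact Set.disjoint_left.1 hdisj hF' hF
  obtain ⟨W, W', hWu, hWd, hok, htr, hok', htr'⟩ := split_all A.E Finset.univ (A.pos i)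
    (Fam (1 - i)) (fun v _ => by
      obtain ⟨u, hu⟩ := A.succ v
      exact ⟨u, Finset.mem_univ _, hu⟩)
  have hex : ∀ (w : List V) (v : V), ∃ u, A.E v u ∧
      (SafeH (A.pos i) A.E (Fam (1 - i)) W (v :: w.reverse) → v ∈ A.pos i →
        SafeH (A.pos i) A.E (Fam (1 - i)) W (u :: v :: w.reverse)) := by
    intro w v
    by_cases h : SafeH (A.pos i) A.E (Fam (1 - i)) W (v :: w.reverse) ∧ v ∈ A.pos i
    · obtain ⟨x, t, he, hx, h1, h2⟩ := safeH_ctl _ _ _ _ _ h.1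
      injection he with e1 e2
      subst e1
      obtain ⟨u, hu, he, hs⟩ := h1 h.2
      exact ⟨u, he, fun _ _ => hs⟩
    · obtain ⟨u, hu⟩ := A.succ v
      exact ⟨u, hu, fun h1 h2 => absurd ⟨h1, h2⟩ h⟩
  choose σ hσ using hex
  refine ⟨σ, fun w v => (hσ w v).1, ?_⟩
  intro v hv ρ hρ0 hc
  have hvW : v ∈ W := by
    have : v ∈ W ∪ W' := hWu ▸ Finset.mem_univ v
    rcases Finset.mem_union.1 this with h | h
    · exact h
    · exact absurd hv (not_win hcompl hok' htr' h)
  have hsafe : ∀ n, SafeH (A.pos i) A.E (Fam (1 - i)) W (rpre ρ n) := by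
    intro n
    induction n with
    | zero =>
      simp only [rpre, hρ0]
      exact hok v hvW [] fun F _ _ => bo_single F v
    | succ n ih =>
      rw [rpre]
      obtain ⟨x, t, he, hx, h1, h2⟩ := safeH_ctl _ _ _ _ _ ih
      have he' := he
      rw [rpre_head] at he'
      injection he' with e1 e2
      subst e1
      by_cases ho : ρ n ∈ A.pos i
      · rw [hc.2 n ho, rpre_head]
        exact (hσ (prefixList ρ n) (ρ n)).2 (rpre_head ρ n ▸ ih) ho
      · exact h2 ho _ (htr _ hx ho _ (Finset.mem_univ _) (hc.1 n)) (hc.1 n)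
  have hW : ∀ n, ρ n ∈ W := by
    intro n
    obtain ⟨x, t, he, hx, _⟩ := safeH_ctl _ _ _ _ _ (hsafe n)
    rw [rpre_head] at he
    injection he with e1 e2
    exact e1 ▸ hx
  constructor
  · have hnb := inf_not_bad ρ hsafe
    have hl := (hcover _).2 (inf_loop A ρ hc.1)
    fin_cases i
    · rcases hl with h | h
      · exact h
      · exact absurd h hnb
    · rcases hl with h | h
      · exact absurd h hnb
      · exact h
  · intro F hF n
    rw [scoreAcc_eq, rpre_eq]
    by_cases hFW : F ⊆ W
    · exact safeH_bdd _ _ _ _ _ (hsafe n) F hF hFW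
    · have : PotLe (↑W) F (sc F (rpre ρ n)) 1 := by
        induction n with
        | zero => exact pot_of_bo (notSub hFW) (bo_single F _)
        | succ n ih => exact pot_step (notSub hFW) (hW _) ih
      exact this.1.trans (by norm_num)
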